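/- The map α ↦ U^C(α)·U^D(α) = ((1 − α)·R − R_m)·(α·R_D) attains its maximum over the interval [α_L, α_U] at the point α*(R), and α*(R) is the unique maximizer (the objective is a strictly concave quadratic in α since R·R_D > 0). [Paper's Eq. (7): closed form of the Nash bargaining solution for the time-allocation problem (6) with disagreement utilities U^C_min = U^D_min = 0.] -/

import Mathlib

/-- The Nash-bargaining time allocation `α*(R) = max(α_L, min((R − R_m)/(2R), α_U))`
(Eq. (7) of the paper). -/
noncomputable def alphaStar (Rm αL αU R : ℝ) : ℝ :=
  max αL (min ((R - Rm) / (2 * R)) αU)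

/-- Variational inequality for the projection `max a (min c b)` of `c` onto `[a, b]`. -/
lemma sub_mul_sub_clamp_nonpos {a b c x : ℝ} (hx : x ∈ Set.Icc a b) :
    (x - max a (min c b)) * (c - max a (min c b)) ≤ 0 := by
  obtain ⟨hax, hxb⟩ := hx
  rcases le_total c b with hcb | hbc
  · rw [min_eq_left hcb]
    rcases le_total a c with hac | hca
    · simp [max_eq_right hac]
    · rw [max_eq_left hca]
      exact mul_nonpos_of_nonneg_of_nonpos (by linarith) (by linarith)
  · rw [min_eq_right hbc, max_eq_right (hax.trans hxb)]
    exact mul_nonpos_of_nonpos_of_nonneg (by linarith) (by linarith)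

/-- Quadratic growth of the Nash product away from `alphaStar`. -/
lemma nashProduct_add_sq_le {Rm αL αU RD R α : ℝ} (hRD : 0 < RD) (hR : 0 < R)
    (hα : α ∈ Set.Icc αL αU) :
    ((1 - α) * R - Rm) * (α * RD) + R * RD * (α - alphaStar Rm αL αU R) ^ 2
      ≤ ((1 - alphaStar Rm αL αU R) * R - Rm) * (alphaStar Rm αL αU R * RD) := by
  have h := sub_mul_sub_clamp_nonpos (c := (R - Rm) / (2 * R)) hα
  change (α - alphaStar Rm αL αU R) * ((R - Rm) / (2 * R) - alphaStar Rm αL αU R) ≤ 0 at h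
  generalize alphaStar Rm αL αU R = s at h ⊢
  have hc : 2 * R * ((R - Rm) / (2 * R)) = R - Rm := by field_simp
  generalize (R - Rm) / (2 * R) = c at h hc
  obtain rfl : Rm = R - 2 * R * c := by linarith
  have := mul_nonpos_of_nonneg_of_nonpos (mul_pos hR hRD).le h
  linarith

/-- Eq. (7): the Nash product `α ↦ U^C(α)·U^D(α) = ((1 − α)·R − R_m)·(α·R_D)` attains its
maximum over `[α_L, α_U]` at `α*(R)`, and `α*(R)` is the unique maximizer. -/
theorem alphaStar_is_unique_maximizer
    (Rm αL αU RD R : ℝ)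
    (hRm : 0 ≤ Rm) (hαL : 0 < αL) (hαLU : αL ≤ αU) (hαU : αU < 1)
    (hRD : 0 < RD) (hR : 0 < R) :
    (∀ α ∈ Set.Icc αL αU,
        ((1 - α) * R - Rm) * (α * RD)
          ≤ ((1 - alphaStar Rm αL αU R) * R - Rm) * (alphaStar Rm αL αU R * RD)) ∧
    (∀ α ∈ Set.Icc αL αU,
        ((1 - α) * R - Rm) * (α * RD)
            = ((1 - alphaStar Rm αL αU R) * R - Rm) * (alphaStar Rm αL αU R * RD) →
          α = alphaStar Rm αL αU R) := by
  refine ⟨fun α hα => ?_, fun α hα heq => ?_⟩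
  · have h := nashProduct_add_sq_le (Rm := Rm) hRD hR hα
    have : 0 ≤ R * RD * (α - alphaStar Rm αL αU R) ^ 2 := by positivity
    linarith
  · have h := nashProduct_add_sq_le (Rm := Rm) hRD hR hα
    by_contra hne
    have : 0 < R * RD * (α - alphaStar Rm αL αU R) ^ 2 :=
      mul_pos (mul_pos hR hRD) (sq_pos_of_ne_zero (sub_ne_zero.mpr hne))
    linarith
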